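/- Let n ≥ 1, 1 ≤ p < ∞, let i ≥ 1 be an integer, let α satisfy 2i < α < 2i+2, and let (φ,ψ) be a parabolic Littlewood–Paley family on ℝ^{n+1}. There exist constants c, C > 0 (depending only on n, p, α, i, φ, ψ) such that for every Schwartz function f on ℝ^{n+1}: c·N_{α,p}(f) ≤ N_{α−2i,p}(f) + Σ_{|β|=2i} N_{α−2i,p}(D_X^β f) + N_{α−2i,p}(D_t^i f) ≤ C·N_{α,p}(f), where the sum is over multi-indices β ∈ ℕⁿ with |β| = 2i and D_t^i denotes the i-th time derivative. -/

import Mathlib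

noncomputable section

open MeasureTheory Real Complex
open scoped ENNReal NNReal Real BigOperators

/-- Euclidean space `ℝⁿ`. -/
abbrev Rn (n : ℕ) : Type := EuclideanSpace ℝ (Fin n)

/-- The space `ℝ^{n+1} = ℝⁿ × ℝ`, points written `(X, t)`. -/
abbrev Rn1 (n : ℕ) : Type := EuclideanSpace ℝ (Fin n) × ℝ

/-- Fourier transform on `ℝ^{n+1}`:
`𝓕f(ξ,τ) = ∫ e^{−2πi(X·ξ + tτ)} f(X,t) dX dt`. -/
def FT1 {n : ℕ} (f : Rn1 n → ℂ) (q : Rn1 n) : ℂ :=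
  ∫ p : Rn1 n,
    Complex.exp (-(2 * (π : ℂ) * Complex.I) *
      (((∑ k, p.1 k * q.1 k) + p.2 * q.2 : ℝ) : ℂ)) * f p

/-- Inverse Fourier transform on `ℝ^{n+1}`. -/
def IFT1 {n : ℕ} (f : Rn1 n → ℂ) (x : Rn1 n) : ℂ :=
  ∫ q : Rn1 n,
    Complex.exp ((2 * (π : ℂ) * Complex.I) *
      (((∑ k, q.1 k * x.1 k) + q.2 * x.2 : ℝ) : ℂ)) * f q

/-- The Fourier multiplier operator `f ↦ 𝓕⁻¹(m · 𝓕 f)` on `ℝ^{n+1}`. -/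
def MOp {n : ℕ} (m : Rn1 n → ℂ) (f : Rn1 n → ℂ) : Rn1 n → ℂ :=
  IFT1 (fun q => m q * FT1 f q)

/-- The symbol `m_α(ξ,τ) = (1 + 4π²|ξ|² + iτ)^{α/2}` (principal branch). -/
def mSym {n : ℕ} (α : ℝ) (q : Rn1 n) : ℂ :=
  (1 + 4 * (π : ℂ) ^ 2 * (‖q.1‖ : ℂ) ^ 2 + Complex.I * (q.2 : ℂ)) ^ ((α : ℂ) / 2)

/-- Partial derivative `∂_{X_k}`. -/
def dX {n : ℕ} (k : Fin n) (f : Rn1 n → ℂ) : Rn1 n → ℂ :=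
  fun x => fderiv ℝ f x (EuclideanSpace.single k 1, 0)

/-- Partial derivative `∂_t`. -/
def dT {n : ℕ} (f : Rn1 n → ℂ) : Rn1 n → ℂ :=
  fun x => fderiv ℝ f x (0, 1)

/-- Iterated spatial derivative `D_X^β` for a multi-index `β`. -/
def dXmulti {n : ℕ} (β : Fin n → ℕ) (f : Rn1 n → ℂ) : Rn1 n → ℂ :=
  (List.finRange n).foldr (fun k g => (dX k)^[β k] g) f

/-- The half time-derivative `D_t^{1/2} f = 𝓕⁻¹(|τ|^{1/2}·𝓕f)`. -/
def halfDt {n : ℕ} (f : Rn1 n → ℂ) : Rn1 n → ℂ :=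
  MOp (fun q => ((|q.2| ^ ((1 : ℝ) / 2) : ℝ) : ℂ)) f

/-- The `Lᵖ(ℝ^{n+1})` norm (as a value in `ℝ≥0∞`), `p` a real exponent. -/
def pNorm {n : ℕ} (p : ℝ) (f : Rn1 n → ℂ) : ℝ≥0∞ :=
  eLpNorm f (ENNReal.ofReal p) volume

/-- Multi-indices `β ∈ ℕⁿ` with `|β| = N`. -/
def multiIdx (n N : ℕ) : Finset (Fin n → ℕ) :=
  (Fintype.piFinset fun _ : Fin n => Finset.range (N + 1)).filter fun β => (∑ k, β k) = N

/-- Convolution on `ℝ^{n+1}`. -/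
def conv1 {n : ℕ} (g f : Rn1 n → ℂ) : Rn1 n → ℂ :=
  fun x => ∫ y : Rn1 n, g (x - y) * f y

/-- A parabolic Littlewood–Paley family on `ℝ^{n+1}`. -/
structure ParabolicLP (n : ℕ) where
  φ : SchwartzMap (Rn1 n) ℂ
  ψ : SchwartzMap (Rn1 n) ℂ
  ft_pos : ∀ q : Rn1 n,
    1 / 2 < ‖q.1‖ + |q.2| ^ ((1 : ℝ) / 2) → ‖q.1‖ + |q.2| ^ ((1 : ℝ) / 2) < 2 →
      0 < (FT1 (⇑φ) q).re ∧ (FT1 (⇑φ) q).im = 0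
  ft_supp : ∀ q : Rn1 n,
    ¬(1 / 2 < ‖q.1‖ + |q.2| ^ ((1 : ℝ) / 2) ∧ ‖q.1‖ + |q.2| ^ ((1 : ℝ) / 2) < 2) →
      FT1 (⇑φ) q = 0
  ft_sum : ∀ q : Rn1 n, q ≠ 0 →
    ∑' i : ℤ, FT1 (⇑φ) (((2 : ℝ) ^ (-i)) • q.1, ((2 : ℝ) ^ (-(2 * i))) * q.2) = 1
  ft_psi : ∀ q : Rn1 n,
    FT1 (⇑ψ) q =
      1 - ∑' i : ℕ,
        FT1 (⇑φ) (((2 : ℝ) ^ (-((i : ℤ) + 1))) • q.1, ((2 : ℝ) ^ (-(2 * ((i : ℤ) + 1)))) * q.2)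

/-- The dilate `φ_i`, whose Fourier transform is `𝓕φ(2^{−i}ξ, 2^{−2i}τ)`. -/
def lpPhi {n : ℕ} (P : ParabolicLP n) (i : ℕ) : Rn1 n → ℂ :=
  fun x => (((2 : ℝ) ^ (i * (n + 2)) : ℝ) : ℂ) *
    P.φ (((2 : ℝ) ^ i) • x.1, ((2 : ℝ) ^ (2 * i)) * x.2)

/-- Parabolic Besov norm `N_{s,p}(f)` on `ℝ^{n+1}`, `1 ≤ p < ∞`. -/
def pBesov {n : ℕ} (P : ParabolicLP n) (s p : ℝ) (f : Rn1 n → ℂ) : ℝ≥0∞ :=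
  eLpNorm (conv1 (⇑P.ψ) f) (ENNReal.ofReal p) volume +
  (∑' i : ℕ,
    (ENNReal.ofReal ((2 : ℝ) ^ (s * ((i : ℝ) + 1))) *
      eLpNorm (conv1 (lpPhi P (i + 1)) f) (ENNReal.ofReal p) volume) ^ p) ^ (1 / p)

/-- Parabolic Besov norm `N_{s,∞}(f)` on `ℝ^{n+1}`. -/
def pBesovInf {n : ℕ} (P : ParabolicLP n) (s : ℝ) (f : Rn1 n → ℂ) : ℝ≥0∞ :=
  max (eLpNorm (conv1 (⇑P.ψ) f) ⊤ volume)
    (⨆ i : ℕ, ENNReal.ofReal ((2 : ℝ) ^ (s * ((i : ℝ) + 1))) *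
      eLpNorm (conv1 (lpPhi P (i + 1)) f) ⊤ volume)

/-- The time interval `(0, T)` for `0 < T ≤ ∞`. -/
def tSet (T : ℝ≥0∞) : Set ℝ := {t : ℝ | 0 < t ∧ ENNReal.ofReal t < T}

/-- Lebesgue measure restricted to the strip `ℝⁿ × (0,T)`. -/
def stripMeasure (n : ℕ) (T : ℝ≥0∞) : Measure (Rn1 n) :=
  volume.restrict {x : Rn1 n | x.2 ∈ tSet T}

/-- The parabolic Sobolev norm `‖g‖_{W^{2i,i}_p(ℝⁿ_T)}`. -/
def wNorm {n : ℕ} (i : ℕ) (p : ℝ) (T : ℝ≥0∞) (g : Rn1 n → ℂ) : ℝ≥0∞ :=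
  ∑ l ∈ Finset.range (i + 1),
    ∑ β ∈ (Fintype.piFinset fun _ : Fin n => Finset.range (2 * i + 1)).filter
        (fun β => (∑ k, β k) + 2 * l ≤ 2 * i),
      eLpNorm (dXmulti β (dT^[l] g)) (ENNReal.ofReal p) (stripMeasure n T)

/-- Time-regularity seminorm `[g]_{t,β,p,T}`. -/
def semT {n : ℕ} (b p : ℝ) (T : ℝ≥0∞) (g : Rn1 n → ℂ) : ℝ≥0∞ :=
  (∫⁻ X : Rn n, ∫⁻ t in tSet T, ∫⁻ s in tSet T,
      ENNReal.ofReal (‖g (X, t) - g (X, s)‖ ^ p / |t - s| ^ (1 + p * b / 2))) ^ (1 / p)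

/-- Space-regularity seminorm `[g]_{x,β,p,T}`. -/
def semX {n : ℕ} (b p : ℝ) (T : ℝ≥0∞) (g : Rn1 n → ℂ) : ℝ≥0∞ :=
  (∫⁻ t in tSet T, ∫⁻ X : Rn n, ∫⁻ Y : Rn n,
      ENNReal.ofReal (‖g (X + Y, t) - 2 * g (X, t) + g (X - Y, t)‖ ^ p /
        ‖Y‖ ^ ((n : ℝ) + p * b))) ^ (1 / p)

/-- The parabolic Besov norm `‖g‖_{B^{α,α/2}_p(ℝⁿ_T)}`, formed with index `i` where
`2i < α < 2i+2`. -/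
def pbNorm {n : ℕ} (i : ℕ) (α p : ℝ) (T : ℝ≥0∞) (g : Rn1 n → ℂ) : ℝ≥0∞ :=
  wNorm i p T g +
  ∑ l ∈ Finset.range (i + 1),
    ∑ β ∈ (Fintype.piFinset fun _ : Fin n => Finset.range (2 * i + 1)).filter
        (fun β => (∑ k, β k) + 2 * l = 2 * i),
      (semT (α - 2 * i) p T (dXmulti β (dT^[l] g)) +
        semX (α - 2 * i) p T (dXmulti β (dT^[l] g)))

/-- Fourier transform on `ℝⁿ`. -/
def FTn {n : ℕ} (f : Rn n → ℂ) (ξ : Rn n) : ℂ :=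
  ∫ x : Rn n, Complex.exp (-(2 * (π : ℂ) * Complex.I) * (((∑ k, x k * ξ k : ℝ)) : ℂ)) * f x

/-- Inverse Fourier transform on `ℝⁿ`. -/
def IFTn {n : ℕ} (f : Rn n → ℂ) (x : Rn n) : ℂ :=
  ∫ ξ : Rn n, Complex.exp ((2 * (π : ℂ) * Complex.I) * (((∑ k, ξ k * x k : ℝ)) : ℂ)) * f ξ

/-- Convolution on `ℝⁿ`. -/
def convn {n : ℕ} (g f : Rn n → ℂ) : Rn n → ℂ := fun x => ∫ y : Rn n, g (x - y) * f y

/-- A Littlewood–Paley family on `ℝⁿ`. -/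
structure LPFamily (n : ℕ) where
  φ : SchwartzMap (Rn n) ℂ
  ψ : SchwartzMap (Rn n) ℂ
  ft_pos : ∀ ξ : Rn n, 1 / 2 < ‖ξ‖ → ‖ξ‖ < 2 →
    0 < (FTn (⇑φ) ξ).re ∧ (FTn (⇑φ) ξ).im = 0
  ft_supp : ∀ ξ : Rn n, ¬(1 / 2 < ‖ξ‖ ∧ ‖ξ‖ < 2) → FTn (⇑φ) ξ = 0
  ft_sum : ∀ ξ : Rn n, ξ ≠ 0 → ∑' i : ℤ, FTn (⇑φ) (((2 : ℝ) ^ (-i)) • ξ) = 1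
  ft_psi : ∀ ξ : Rn n,
    FTn (⇑ψ) ξ = 1 - ∑' i : ℕ, FTn (⇑φ) (((2 : ℝ) ^ (-((i : ℤ) + 1))) • ξ)

/-- The dilate `φ′_i(x) = 2^{in} φ′(2^i x)`. -/
def lpPhin {n : ℕ} (P : LPFamily n) (i : ℕ) : Rn n → ℂ :=
  fun x => (((2 : ℝ) ^ (i * n) : ℝ) : ℂ) * P.φ (((2 : ℝ) ^ i) • x)

/-- Besov norm `B_{s,p}(f)` on `ℝⁿ`, `1 ≤ p < ∞`. -/
def besovN {n : ℕ} (P : LPFamily n) (s p : ℝ) (f : Rn n → ℂ) : ℝ≥0∞ :=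
  eLpNorm (convn (⇑P.ψ) f) (ENNReal.ofReal p) volume +
  (∑' i : ℕ,
    (ENNReal.ofReal ((2 : ℝ) ^ (s * ((i : ℝ) + 1))) *
      eLpNorm (convn (lpPhin P (i + 1)) f) (ENNReal.ofReal p) volume) ^ p) ^ (1 / p)

/-- The heat kernel `Γ(X,t)` on `ℝⁿ` (zero for `t ≤ 0`). -/
def heatKer (n : ℕ) (X : Rn n) (t : ℝ) : ℝ :=
  if 0 < t then (4 * π * t) ^ (-(n : ℝ) / 2) * Real.exp (-‖X‖ ^ 2 / (4 * t)) else 0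

/-- The heat extension `u(X,t) = ∫ Γ(X−Y,t) f(Y) dY`. -/
def heatExt {n : ℕ} (f : Rn n → ℂ) : Rn1 n → ℂ :=
  fun x => ∫ Y : Rn n, (heatKer n (x.1 - Y) x.2 : ℂ) * f Y

open scoped SchwartzMap FourierTransform LineDeriv Convolution ContDiff

/-- The identity from the inner product space `WithLp 2 (ℝⁿ × ℝ)` to `ℝ^{n+1}`. -/
def l2Equiv (n : ℕ) : WithLp 2 (Rn n × ℝ) ≃L[ℝ] Rn1 n :=
  WithLp.prodContinuousLinearEquiv 2 ℝ (Rn n) ℝ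

theorem measurePreserving_l2Equiv (n : ℕ) : MeasurePreserving (l2Equiv n) :=
  WithLp.volume_preserving_ofLp (Rn n) ℝ

theorem measurableEmbedding_l2Equiv (n : ℕ) : MeasurableEmbedding (l2Equiv n) :=
  (l2Equiv n).toHomeomorph.measurableEmbedding

/-- Transport of a Schwartz function to the inner product space `WithLp 2 (ℝⁿ × ℝ)`. -/
def toL2 {n : ℕ} (f : 𝓢(Rn1 n, ℂ)) : 𝓢(WithLp 2 (Rn n × ℝ), ℂ) :=
  SchwartzMap.compCLMOfContinuousLinearEquiv ℂ (l2Equiv n) f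

/-- Transport of a Schwartz function from the inner product space `WithLp 2 (ℝⁿ × ℝ)`. -/
def ofL2 {n : ℕ} (f : 𝓢(WithLp 2 (Rn n × ℝ), ℂ)) : 𝓢(Rn1 n, ℂ) :=
  SchwartzMap.compCLMOfContinuousLinearEquiv ℂ (l2Equiv n).symm f

theorem toL2_apply {n : ℕ} (f : 𝓢(Rn1 n, ℂ)) (w) : toL2 f w = f (l2Equiv n w) := rfl

theorem ofL2_apply {n : ℕ} (f : 𝓢(WithLp 2 (Rn n × ℝ), ℂ)) (x) :
    ofL2 f x = f ((l2Equiv n).symm x) := rfl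

theorem toL2_ofL2 {n : ℕ} (f : 𝓢(WithLp 2 (Rn n × ℝ), ℂ)) : toL2 (ofL2 f) = f := by
  ext w; simp [toL2_apply, ofL2_apply]

theorem ofL2_toL2 {n : ℕ} (f : 𝓢(Rn1 n, ℂ)) : ofL2 (toL2 f) = f := by
  ext w; simp [toL2_apply, ofL2_apply]

theorem FT1_l2Equiv {n : ℕ} (f : 𝓢(Rn1 n, ℂ)) (w : WithLp 2 (Rn n × ℝ)) :
    FT1 f (l2Equiv n w) = 𝓕 (toL2 f) w := by
  rw [SchwartzMap.fourier_coe, Real.fourier_eq', FT1,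
    ← (measurePreserving_l2Equiv n).integral_comp (measurableEmbedding_l2Equiv n)]
  congr with v
  simp only [smul_eq_mul, toL2_apply]
  congr 2
  simp [WithLp.prod_inner_apply, PiLp.inner_apply, l2Equiv]
  ring_nf
  simp [mul_comm, Finset.mul_sum, add_comm]

theorem FT1_eq {n : ℕ} (f : 𝓢(Rn1 n, ℂ)) (q : Rn1 n) :
    FT1 f q = 𝓕 (toL2 f) ((l2Equiv n).symm q) := by
  rw [← FT1_l2Equiv, ContinuousLinearEquiv.apply_symm_apply]

theorem FT1_injective {n : ℕ} {f g : 𝓢(Rn1 n, ℂ)} (h : ∀ q, FT1 f q = FT1 g q) : f = g := by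
  have : 𝓕 (toL2 f) = 𝓕 (toL2 g) := by
    ext w; rw [← FT1_l2Equiv, ← FT1_l2Equiv, h]
  have h2 : toL2 f = toL2 g := by
    simpa using congrArg (fun F : 𝓢(WithLp 2 (Rn n × ℝ), ℂ) => 𝓕⁻ F) this
  rw [← ofL2_toL2 f, h2, ofL2_toL2]

theorem exists_FT1_eq {n : ℕ} {m : Rn1 n → ℂ} (hm : ContDiff ℝ ∞ m) (hc : HasCompactSupport m) :
    ∃ K : 𝓢(Rn1 n, ℂ), ∀ q, FT1 K q = m q := by
  refine ⟨ofL2 (𝓕⁻ (toL2 (hc.toSchwartzMap hm))), fun q => ?_⟩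
  rw [FT1_eq, toL2_ofL2, FourierTransform.fourier_fourierInv_eq, toL2_apply]
  simp

/-- Convolution of Schwartz functions on `ℝ^{n+1}`, as a Schwartz function. -/
def schwartzConv {n : ℕ} (g f : 𝓢(Rn1 n, ℂ)) : 𝓢(Rn1 n, ℂ) :=
  ofL2 (SchwartzMap.convolution (ContinuousLinearMap.mul ℂ ℂ) (toL2 g) (toL2 f))

theorem coe_schwartzConv {n : ℕ} (g f : 𝓢(Rn1 n, ℂ)) : ⇑(schwartzConv g f) = conv1 g f := by
  ext x
  rw [schwartzConv, ofL2_apply, SchwartzMap.convolution_apply, convolution_eq_swap, conv1,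
    ← (measurePreserving_l2Equiv n).integral_comp (measurableEmbedding_l2Equiv n)]
  simp [toL2_apply]

theorem FT1_schwartzConv {n : ℕ} (g f : 𝓢(Rn1 n, ℂ)) (q : Rn1 n) :
    FT1 (schwartzConv g f) q = FT1 g q * FT1 f q := by
  rw [FT1_eq, FT1_eq, FT1_eq, schwartzConv, toL2_ofL2, SchwartzMap.fourier_convolution,
    SchwartzMap.pairing_apply_apply]
  rfl

theorem FT1_lineDeriv {n : ℕ} (f : 𝓢(Rn1 n, ℂ)) (v q : Rn1 n) :
    FT1 (∂_{v} f : 𝓢(Rn1 n, ℂ)) q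
      = 2 * π * I * ((∑ k, q.1 k * v.1 k) + q.2 * v.2 : ℝ) * FT1 f q := by
  have h : toL2 (∂_{v} f) = ∂_{(l2Equiv n).symm v} (toL2 f) := by
    rw [toL2, toL2, SchwartzMap.lineDerivOp_compCLMOfContinuousLinearEquiv,
      ContinuousLinearEquiv.apply_symm_apply]
  have hg : (fun w : WithLp 2 (Rn n × ℝ) => inner ℝ w ((l2Equiv n).symm v)).HasTemperateGrowth :=
    ((innerSL ℝ).flip ((l2Equiv n).symm v)).hasTemperateGrowth
  rw [FT1_eq, FT1_eq, h, SchwartzMap.fourier_lineDerivOp_eq]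
  rw [smul_apply, SchwartzMap.smulLeftCLM_apply_apply hg]
  simp [WithLp.prod_inner_apply, PiLp.inner_apply, l2Equiv, mul_comm, mul_assoc]

theorem FT1_sum_smul {n : ℕ} {ι : Type*} (s : Finset ι) (c : ι → ℂ) (f : ι → 𝓢(Rn1 n, ℂ))
    (q : Rn1 n) : FT1 (∑ a ∈ s, c a • f a : 𝓢(Rn1 n, ℂ)) q = ∑ a ∈ s, c a * FT1 (f a) q := by
  have h (g : 𝓢(Rn1 n, ℂ)) : FT1 g q = (FourierTransform.fourierCLM ℂ 𝓢(WithLp 2 (Rn n × ℝ), ℂ)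
      (SchwartzMap.compCLMOfContinuousLinearEquiv ℂ (l2Equiv n) g)) ((l2Equiv n).symm q) :=
    FT1_eq g q
  simp only [h, map_sum, map_smul, _root_.sum_apply, smul_apply, smul_eq_mul]

instance isAddHaarMeasure_volume_Rn1 (n : ℕ) :
    (volume : Measure (Rn1 n)).IsAddHaarMeasure :=
  inferInstanceAs ((volume : Measure (Rn n)).prod (volume : Measure ℝ)).IsAddHaarMeasure

/-- The parabolic dilation `(X, t) ↦ (r X, r² t)`. -/
def parDilation (n : ℕ) (r : ℝˣ) : Rn1 n ≃L[ℝ] Rn1 n :=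
  (ContinuousLinearEquiv.smulLeft r).prodCongr (ContinuousLinearEquiv.smulLeft (r ^ 2))

theorem parDilation_apply {n : ℕ} (r : ℝˣ) (x : Rn1 n) :
    parDilation n r x = ((r : ℝ) • x.1, (r : ℝ) ^ 2 * x.2) := by
  refine Prod.ext rfl ?_
  change ((r ^ 2 : ℝˣ) : ℝ) * x.2 = _
  simp

theorem measurableEmbedding_parDilation (n : ℕ) (r : ℝˣ) :
    MeasurableEmbedding (parDilation n r) :=
  (parDilation n r).toHomeomorph.measurableEmbedding

theorem map_parDilation (n : ℕ) (r : ℝˣ) :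
    Measure.map (parDilation n r) volume
      = ENNReal.ofReal (|(r : ℝ)| ^ (n + 2))⁻¹ • (volume : Measure (Rn1 n)) := by
  have h1 : (parDilation n r : Rn1 n → Rn1 n)
      = Prod.map (fun X : Rn n => (r : ℝ) • X) (fun t : ℝ => ((r : ℝ) ^ 2) • t) := by
    ext1 x; rw [parDilation_apply]; rfl
  have hr : (r : ℝ) ≠ 0 := r.ne_zero
  rw [h1, Measure.volume_eq_prod, ← Measure.map_prod_map _ _ (by fun_prop) (by fun_prop),
    Measure.map_addHaar_smul _ hr, Measure.map_addHaar_smul _ (pow_ne_zero 2 hr),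
    Measure.prod_smul_left, Measure.prod_smul_right, smul_smul,
    ← ENNReal.ofReal_mul (abs_nonneg _)]
  congr 2
  simp [abs_inv, abs_pow, pow_add, mul_comm]

theorem integral_comp_parDilation {n : ℕ} (r : ℝˣ) (g : Rn1 n → ℂ) :
    ∫ x, ((|(r : ℝ)| ^ (n + 2) : ℝ) : ℂ) * g (parDilation n r x) = ∫ x, g x := by
  have hr : |(r : ℝ)| ^ (n + 2) ≠ 0 := pow_ne_zero _ (abs_ne_zero.2 r.ne_zero)
  rw [integral_const_mul,
    ← (measurableEmbedding_parDilation n r).integral_map g]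
  rw [map_parDilation, integral_smul_measure,
    ENNReal.toReal_ofReal (by positivity), Complex.real_smul, ← mul_assoc, ← Complex.ofReal_mul,
    mul_inv_cancel₀ hr, Complex.ofReal_one, one_mul]

theorem lintegral_comp_parDilation {n : ℕ} (r : ℝˣ) (g : Rn1 n → ℝ≥0∞) :
    ∫⁻ x, ENNReal.ofReal (|(r : ℝ)| ^ (n + 2)) * g (parDilation n r x) = ∫⁻ x, g x := by
  have hr : 0 < |(r : ℝ)| ^ (n + 2) := pow_pos (abs_pos.2 r.ne_zero) _
  rw [lintegral_const_mul' _ _ ENNReal.ofReal_ne_top,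
    ← (measurableEmbedding_parDilation n r).lintegral_map g]
  rw [map_parDilation, lintegral_smul_measure, smul_eq_mul, ← mul_assoc,
    ← ENNReal.ofReal_mul hr.le, mul_inv_cancel₀ hr.ne', ENNReal.ofReal_one, one_mul]

/-- The `L¹`-normalized parabolic dilate of a Schwartz function. -/
def schwartzDilate {n : ℕ} (r : ℝˣ) (K : 𝓢(Rn1 n, ℂ)) : 𝓢(Rn1 n, ℂ) :=
  ((|(r : ℝ)| ^ (n + 2) : ℝ) : ℂ) •
    SchwartzMap.compCLMOfContinuousLinearEquiv ℂ (parDilation n r) K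

theorem schwartzDilate_apply {n : ℕ} (r : ℝˣ) (K : 𝓢(Rn1 n, ℂ)) (x : Rn1 n) :
    schwartzDilate r K x = ((|(r : ℝ)| ^ (n + 2) : ℝ) : ℂ) * K (parDilation n r x) := rfl

theorem eLpNorm_schwartzDilate {n : ℕ} (r : ℝˣ) (K : 𝓢(Rn1 n, ℂ)) :
    eLpNorm (schwartzDilate r K) 1 volume = eLpNorm K 1 volume := by
  rw [eLpNorm_one_eq_lintegral_enorm, eLpNorm_one_eq_lintegral_enorm]
  refine Eq.trans ?_ (lintegral_comp_parDilation r _)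
  congr with x
  rw [schwartzDilate_apply, enorm_mul, ← ofReal_norm, Complex.norm_real, Real.norm_eq_abs,
    abs_of_nonneg (by positivity)]

theorem FT1_schwartzDilate {n : ℕ} (r : ℝˣ) (K : 𝓢(Rn1 n, ℂ)) (q : Rn1 n) :
    FT1 (schwartzDilate r K) q = FT1 K (parDilation n r⁻¹ q) := by
  rw [FT1, FT1]
  refine Eq.trans ?_ (integral_comp_parDilation r _)
  congr with x
  rw [schwartzDilate_apply]
  have : (∑ k, (parDilation n r x).1 k * (parDilation n r⁻¹ q).1 k)
      + (parDilation n r x).2 * (parDilation n r⁻¹ q).2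
      = (∑ k, x.1 k * q.1 k) + x.2 * q.2 := by
    have hr : (r : ℝ) ≠ 0 := r.ne_zero
    simp only [parDilation_apply, PiLp.smul_apply, smul_eq_mul, Units.val_inv_eq_inv_val]
    congr 1
    · refine Finset.sum_congr rfl fun k _ => ?_
      field_simp
    · field_simp
  rw [this]
  ring

/-- The unit `2^j` of `ℝ`. -/
def twoPow (j : ℕ) : ℝˣ := Units.mk0 ((2 : ℝ) ^ j) (by positivity)

theorem lpPhi_eq_schwartzDilate {n : ℕ} (P : ParabolicLP n) (j : ℕ) :
    lpPhi P j = schwartzDilate (twoPow j) P.φ := by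
  ext x
  rw [schwartzDilate_apply, parDilation_apply, lpPhi]
  have h : |((twoPow j : ℝˣ) : ℝ)| = 2 ^ j := abs_of_pos (by simp [twoPow])
  rw [h, ← pow_mul]
  simp [twoPow, ← pow_mul, mul_comm]

theorem enorm_conv1_le {n : ℕ} (K g : 𝓢(Rn1 n, ℂ)) (x : Rn1 n) :
    ‖conv1 K g x‖ₑ ≤ ∫⁻ z, ‖K z‖ₑ * ‖g (x - z)‖ₑ := by
  refine (enorm_integral_le_lintegral_enorm _).trans_eq ?_
  refine (lintegral_sub_left_eq_self _ x).symm.trans ?_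
  simp [enorm_mul]

/-- Young's inequality for convolution with an integrable kernel. -/
theorem eLpNorm_conv1_le {n : ℕ} {p : ℝ} (hp : 1 ≤ p) (K g : 𝓢(Rn1 n, ℂ)) :
    eLpNorm (conv1 K g) (ENNReal.ofReal p) volume
      ≤ eLpNorm K 1 volume * eLpNorm g (ENNReal.ofReal p) volume := by
  have hp0 : 0 < p := by linarith
  have hP0 : ENNReal.ofReal p ≠ 0 := by simpa using hp0
  have hP1 : 1 ≤ ENNReal.ofReal p := by simpa using hp
  have hKm : Measurable fun z => ‖K z‖ₑ := K.continuous.enorm.measurable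
  have hgm : Measurable fun z => ‖g z‖ₑ := g.continuous.enorm.measurable
  set ν : Measure (Rn1 n) := volume.withDensity fun z => ‖K z‖ₑ with hν
  have hνu : ν Set.univ = eLpNorm K 1 volume := by
    rw [hν, withDensity_apply _ MeasurableSet.univ, Measure.restrict_univ,
      eLpNorm_one_eq_lintegral_enorm]
  have hfin : eLpNorm K 1 volume < ⊤ := (K.memLp 1 volume).2
  have : IsFiniteMeasure ν := ⟨by rwa [hνu]⟩
  set M := eLpNorm K 1 volume
  have hpt (x : Rn1 n) : ‖conv1 K g x‖ₑ ^ p ≤ M ^ (p - 1) * ∫⁻ z, ‖g (x - z)‖ₑ ^ p ∂ν := by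
    have h1 : ‖conv1 K g x‖ₑ ≤ eLpNorm (fun z => g (x - z)) 1 ν := by
      refine (enorm_conv1_le K g x).trans_eq ?_
      rw [eLpNorm_one_eq_lintegral_enorm, hν, lintegral_withDensity_eq_lintegral_mul _ hKm
        (g := fun z => ‖g (x - z)‖ₑ) (hgm.comp (measurable_const.sub measurable_id))]
      rfl
    have h2 := eLpNorm_le_eLpNorm_mul_rpow_measure_univ (μ := ν) hP1
      (f := fun z => g (x - z)) (by fun_prop)
    rw [eLpNorm_eq_lintegral_rpow_enorm_toReal hP0 ENNReal.ofReal_ne_top,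
      ENNReal.toReal_ofReal hp0.le, hνu] at h2
    calc ‖conv1 K g x‖ₑ ^ p ≤ _ := ENNReal.rpow_le_rpow (h1.trans h2) hp0.le
      _ = _ := by
        rw [ENNReal.mul_rpow_of_nonneg _ _ hp0.le, ← ENNReal.rpow_mul, ← ENNReal.rpow_mul,
          one_div, inv_mul_cancel₀ hp0.ne', ENNReal.rpow_one, mul_comm]
        congr 2
        simp
        field_simp
  have hsub : Measurable fun w : Rn1 n × Rn1 n => ‖g (w.1 - w.2)‖ₑ ^ p :=
    (hgm.comp (measurable_fst.sub measurable_snd)).pow_const p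
  have key : ∫⁻ x, ‖conv1 K g x‖ₑ ^ p ≤ M ^ p * ∫⁻ x, ‖g x‖ₑ ^ p := by
    calc ∫⁻ x, ‖conv1 K g x‖ₑ ^ p
        ≤ ∫⁻ x, M ^ (p - 1) * ∫⁻ z, ‖g (x - z)‖ₑ ^ p ∂ν := lintegral_mono hpt
      _ = M ^ (p - 1) * ∫⁻ z, (∫⁻ x, ‖g (x - z)‖ₑ ^ p) ∂ν := by
        rw [lintegral_const_mul _ hsub.lintegral_prod_right',
          lintegral_lintegral_swap hsub.aemeasurable]
      _ = M ^ (p - 1) * (M * ∫⁻ x, ‖g x‖ₑ ^ p) := by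
        simp_rw [lintegral_sub_right_eq_self (fun x => ‖g x‖ₑ ^ p)]
        rw [lintegral_const, hνu, mul_comm M]
      _ = M ^ p * ∫⁻ x, ‖g x‖ₑ ^ p := by
        rw [← mul_assoc]
        congr 1
        nth_rw 2 [← ENNReal.rpow_one M]
        rw [← ENNReal.rpow_add_of_nonneg _ _ (by linarith) zero_le_one, sub_add_cancel]
  rw [eLpNorm_eq_lintegral_rpow_enorm_toReal hP0 ENNReal.ofReal_ne_top,
    eLpNorm_eq_lintegral_rpow_enorm_toReal hP0 ENNReal.ofReal_ne_top,
    ENNReal.toReal_ofReal hp0.le]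
  refine (ENNReal.rpow_le_rpow key (by positivity)).trans_eq ?_
  rw [ENNReal.mul_rpow_of_nonneg _ _ (by positivity), ← ENNReal.rpow_mul,
    mul_one_div_cancel hp0.ne', ENNReal.rpow_one]

theorem exists_iterate_lineDeriv {n : ℕ} (v : Rn1 n) (m : ℕ) (f : 𝓢(Rn1 n, ℂ)) :
    ∃ g : 𝓢(Rn1 n, ℂ), ⇑g = (fun h : Rn1 n → ℂ => fun x => fderiv ℝ h x v)^[m] f ∧
      ∀ q, FT1 g q = (2 * π * I * ((∑ k, q.1 k * v.1 k) + q.2 * v.2 : ℝ)) ^ m * FT1 f q := by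
  induction m with
  | zero => exact ⟨f, rfl, fun q => by simp⟩
  | succ m ih =>
    obtain ⟨g, hg, hF⟩ := ih
    refine ⟨∂_{v} g, ?_, fun q => ?_⟩
    · rw [Function.iterate_succ_apply', ← hg]
      ext x
      exact SchwartzMap.lineDerivOp_apply_eq_fderiv v g x
    · rw [FT1_lineDeriv, hF, pow_succ']
      ring

theorem exists_iterate_dT {n : ℕ} (m : ℕ) (f : 𝓢(Rn1 n, ℂ)) :
    ∃ g : 𝓢(Rn1 n, ℂ), ⇑g = dT^[m] f ∧
      ∀ q, FT1 g q = (2 * π * I * q.2) ^ m * FT1 f q := by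
  obtain ⟨g, hg, hF⟩ := exists_iterate_lineDeriv ((0, 1) : Rn1 n) m f
  exact ⟨g, hg, fun q => by simpa using hF q⟩

theorem exists_iterate_dX {n : ℕ} (k : Fin n) (m : ℕ) (f : 𝓢(Rn1 n, ℂ)) :
    ∃ g : 𝓢(Rn1 n, ℂ), ⇑g = (dX k)^[m] f ∧
      ∀ q, FT1 g q = (2 * π * I * q.1 k) ^ m * FT1 f q := by
  obtain ⟨g, hg, hF⟩ := exists_iterate_lineDeriv ((EuclideanSpace.single k 1, 0) : Rn1 n) m f
  exact ⟨g, hg, fun q => by simpa using hF q⟩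

theorem exists_dXmulti {n : ℕ} (β : Fin n → ℕ) (f : 𝓢(Rn1 n, ℂ)) :
    ∃ g : 𝓢(Rn1 n, ℂ), ⇑g = dXmulti β f ∧
      ∀ q, FT1 g q = (∏ k, (2 * π * I * q.1 k) ^ β k) * FT1 f q := by
  have h (l : List (Fin n)) : ∃ g : 𝓢(Rn1 n, ℂ),
      ⇑g = l.foldr (fun k g => (dX k)^[β k] g) f ∧
      ∀ q, FT1 g q = (l.map fun k => (2 * π * I * q.1 k) ^ β k).prod * FT1 f q := by
    induction l with
    | nil => exact ⟨f, rfl, fun q => by simp⟩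
    | cons k l ih =>
      obtain ⟨g, hg, hF⟩ := ih
      obtain ⟨g', hg', hF'⟩ := exists_iterate_dX k (β k) g
      refine ⟨g', by rw [hg', hg, List.foldr_cons], fun q => ?_⟩
      rw [hF', hF, List.map_cons, List.prod_cons]
      ring
  obtain ⟨g, hg, hF⟩ := h (List.finRange n)
  exact ⟨g, hg, fun q => by rw [hF, Fin.prod_univ_def]⟩

/-- The operators `D_t^i` (at `none`) and `D_X^β` (at `some β`). -/
def derivOp {n : ℕ} (i : ℕ) : Option (Fin n → ℕ) → (Rn1 n → ℂ) → Rn1 n → ℂ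
  | none => dT^[i]
  | some β => dXmulti β

/-- The Fourier symbol of `derivOp`. -/
def derivSymbol {n : ℕ} (i : ℕ) : Option (Fin n → ℕ) → Rn1 n → ℂ
  | none => fun q => (2 * π * I * q.2) ^ i
  | some β => fun q => ∏ k, (2 * π * I * q.1 k) ^ β k

theorem exists_derivOp {n : ℕ} (i : ℕ) (a : Option (Fin n → ℕ)) (f : 𝓢(Rn1 n, ℂ)) :
    ∃ g : 𝓢(Rn1 n, ℂ), ⇑g = derivOp i a f ∧ ∀ q, FT1 g q = derivSymbol i a q * FT1 f q := by
  cases a with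
  | none => exact exists_iterate_dT i f
  | some β => exact exists_dXmulti β f

theorem contDiff_derivSymbol {n : ℕ} (i : ℕ) (a : Option (Fin n → ℕ)) :
    ContDiff ℝ ∞ (derivSymbol (n := n) i a) := by
  cases a with
  | none =>
    have h : ContDiff ℝ ∞ fun q : Rn1 n => (q.2 : ℂ) := ofRealCLM.contDiff.comp contDiff_snd
    exact (contDiff_const.mul h).pow i
  | some β =>
    refine contDiff_prod fun k _ => ContDiff.pow (contDiff_const.mul ?_) _
    exact ofRealCLM.contDiff.comp
      ((EuclideanSpace.proj (𝕜 := ℝ) k).contDiff.comp (contDiff_fst (𝕜 := ℝ)))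

theorem derivSymbol_parDilation {n i : ℕ} {a : Option (Fin n → ℕ)}
    (ha : a ∈ (multiIdx n (2 * i)).insertNone) (r : ℝˣ) (q : Rn1 n) :
    derivSymbol i a (parDilation n r q) = (r : ℂ) ^ (2 * i) * derivSymbol i a q := by
  cases a with
  | none =>
    simp only [derivSymbol, parDilation_apply, ofReal_mul, ofReal_pow]
    rw [pow_mul, ← mul_pow]
    ring
  | some β =>
    have hβ : ∑ k, β k = 2 * i := by
      simpa [multiIdx] using (Finset.mem_filter.1 (Finset.some_mem_insertNone.1 ha)).2
    simp only [derivSymbol, parDilation_apply, PiLp.smul_apply, smul_eq_mul, ofReal_mul]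
    rw [← hβ, ← Finset.prod_pow_eq_pow_sum, ← Finset.prod_mul_distrib]
    refine Finset.prod_congr rfl fun k _ => ?_
    rw [← mul_pow]
    ring

theorem exists_derivSymbol_ne_zero {n i : ℕ} {q : Rn1 n} (hq : q ≠ 0) :
    ∃ a ∈ (multiIdx n (2 * i)).insertNone, derivSymbol i a q ≠ 0 := by
  by_cases ht : q.2 = 0
  · obtain ⟨k, hk⟩ : ∃ k, q.1 k ≠ 0 := by
      by_contra! h
      exact hq (Prod.ext (PiLp.ext h) ht)
    refine ⟨some (Pi.single k (2 * i)), Finset.some_mem_insertNone.2 ?_, ?_⟩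
    · refine Finset.mem_filter.2 ⟨Fintype.mem_piFinset.2 fun j => ?_, by simp⟩
      rw [Finset.mem_range, Pi.single_apply]
      split_ifs <;> omega
    · refine Finset.prod_ne_zero_iff.2 fun j _ => ?_
      by_cases hj : j = k
      · subst hj
        exact pow_ne_zero _ (by simp [hk, pi_ne_zero])
      · simp [hj]
  · exact ⟨none, by simp, pow_ne_zero _ (by simp [ht, pi_ne_zero])⟩

/-- A smooth substitute `|ξ|⁴ + τ²` for the fourth power of the parabolic distance. -/
def parGauge {n : ℕ} (q : Rn1 n) : ℝ := (‖q.1‖ ^ 2) ^ 2 + q.2 ^ 2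

theorem contDiff_parGauge (n : ℕ) : ContDiff ℝ ∞ (parGauge (n := n)) :=
  (((contDiff_norm_sq ℝ).comp contDiff_fst).pow 2).add (contDiff_snd.pow 2)

theorem parGauge_le {n : ℕ} {q : Rn1 n} (h : ‖q.1‖ + |q.2| ^ ((1 : ℝ) / 2) ≤ 2) :
    parGauge q ≤ 32 := by
  rw [← Real.sqrt_eq_rpow] at h
  have h1 := norm_nonneg q.1
  have h2 := Real.sqrt_nonneg |q.2|
  have h3 : ‖q.1‖ ^ 4 ≤ 2 ^ 4 := pow_le_pow_left₀ h1 (by linarith) 4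
  have h4 : √|q.2| ^ 4 ≤ 2 ^ 4 := pow_le_pow_left₀ h2 (by linarith) 4
  have h5 : √|q.2| ^ 4 = q.2 ^ 2 := by
    rw [show 4 = 2 * 2 from rfl, pow_mul, Real.sq_sqrt (abs_nonneg _), sq_abs]
  rw [parGauge, ← pow_mul]
  norm_num at h3 h4 ⊢
  linarith

theorem le_parGauge {n : ℕ} {q : Rn1 n} (h : 1 / 2 ≤ ‖q.1‖ + |q.2| ^ ((1 : ℝ) / 2)) :
    1 / 256 ≤ parGauge q := by
  rw [← Real.sqrt_eq_rpow] at h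
  have h5 : √|q.2| ^ 4 = q.2 ^ 2 := by
    rw [show 4 = 2 * 2 from rfl, pow_mul, Real.sq_sqrt (abs_nonneg _), sq_abs]
  rw [parGauge, ← pow_mul, ← h5]
  rcases le_total (1 / 4) ‖q.1‖ with h1 | h1
  · have := pow_le_pow_left₀ (by norm_num) h1 4
    have h2 : 0 ≤ √|q.2| ^ 4 := by positivity
    norm_num at this ⊢
    linarith
  · have := pow_le_pow_left₀ (by norm_num) (show 1 / 4 ≤ √|q.2| by linarith) 4
    have h2 : 0 ≤ ‖q.1‖ ^ 4 := by positivity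
    norm_num at this ⊢
    linarith

/-- A smooth compactly supported function equal to `1` on the parabolic ball of radius `2`. -/
def parCutoff {n : ℕ} (q : Rn1 n) : ℝ := Real.smoothTransition (34 - parGauge q)

theorem contDiff_parCutoff (n : ℕ) : ContDiff ℝ ∞ (parCutoff (n := n)) :=
  Real.smoothTransition.contDiff.comp (contDiff_const.sub (contDiff_parGauge n))

theorem parCutoff_eq_one {n : ℕ} {q : Rn1 n} (h : ‖q.1‖ + |q.2| ^ ((1 : ℝ) / 2) ≤ 2) :
    parCutoff q = 1 :=
  Real.smoothTransition.one_of_one_le (by linarith [parGauge_le h])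

theorem hasCompactSupport_parCutoff (n : ℕ) : HasCompactSupport (parCutoff (n := n)) := by
  refine HasCompactSupport.of_support_subset_isCompact (isCompact_closedBall (0 : Rn1 n) 6)
    fun q hq => ?_
  have hg : parGauge q < 34 := by
    by_contra! h
    exact hq (Real.smoothTransition.zero_of_nonpos (by linarith))
  rw [parGauge] at hg
  rw [mem_closedBall_zero_iff, Prod.norm_def, max_le_iff]
  constructor
  · nlinarith [sq_nonneg q.2, sq_nonneg (‖q.1‖ ^ 2), norm_nonneg q.1, sq_nonneg (‖q.1‖^2 - 6)]
  · rw [Real.norm_eq_abs]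
    exact abs_le_of_sq_le_sq (by nlinarith [sq_nonneg (‖q.1‖ ^ 2)]) (by norm_num)

/-- A smooth positive function which is `∑ |m_a|²` away from the origin, where `m_a` are the
symbols of `D_t^i` and of `D_X^β`, `|β| = 2i`. -/
def symbolDenom {n : ℕ} (i : ℕ) (q : Rn1 n) : ℝ :=
  ∑ a ∈ (multiIdx n (2 * i)).insertNone, ‖derivSymbol i a q‖ ^ 2
    + Real.smoothTransition (1 - 256 * parGauge q)

theorem contDiff_symbolDenom (n i : ℕ) : ContDiff ℝ ∞ (symbolDenom (n := n) i) := by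
  refine ContDiff.add (ContDiff.sum fun a _ => (contDiff_derivSymbol i a).norm_sq ℝ) ?_
  exact Real.smoothTransition.contDiff.comp
    (contDiff_const.sub (contDiff_const.mul (contDiff_parGauge n)))

theorem symbolDenom_pos {n : ℕ} (i : ℕ) (q : Rn1 n) : 0 < symbolDenom i q := by
  have h0 : 0 ≤ ∑ a ∈ (multiIdx n (2 * i)).insertNone, ‖derivSymbol i a q‖ ^ 2 :=
    Finset.sum_nonneg fun _ _ => by positivity
  by_cases hq : q = 0
  · refine add_pos_of_nonneg_of_pos h0 (Real.smoothTransition.pos_of_pos ?_)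
    simp [hq, parGauge]
  · obtain ⟨a, ha, hne⟩ := exists_derivSymbol_ne_zero (i := i) hq
    refine add_pos_of_pos_of_nonneg (Finset.sum_pos' (fun _ _ => by positivity) ⟨a, ha, ?_⟩)
      (Real.smoothTransition.nonneg _)
    positivity

theorem symbolDenom_eq {n : ℕ} (i : ℕ) {q : Rn1 n}
    (h : 1 / 2 ≤ ‖q.1‖ + |q.2| ^ ((1 : ℝ) / 2)) :
    symbolDenom i q = ∑ a ∈ (multiIdx n (2 * i)).insertNone, ‖derivSymbol i a q‖ ^ 2 := by
  rw [symbolDenom, Real.smoothTransition.zero_of_nonpos (by linarith [le_parGauge h]), add_zero]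

theorem exists_derivative_kernel (n i : ℕ) (a : Option (Fin n → ℕ)) :
    ∃ K : 𝓢(Rn1 n, ℂ), ∀ q, FT1 K q = parCutoff q * derivSymbol i a q := by
  have hc : ContDiff ℝ ∞ fun q : Rn1 n => (parCutoff q : ℂ) :=
    ofRealCLM.contDiff.comp (contDiff_parCutoff n)
  refine exists_FT1_eq (hc.mul (contDiff_derivSymbol i a)) ?_
  exact ((hasCompactSupport_parCutoff n).comp_left ofReal_zero).mul_right

theorem exists_inverse_kernel (n i : ℕ) (a : Option (Fin n → ℕ)) :
    ∃ L : 𝓢(Rn1 n, ℂ), ∀ q,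
      FT1 L q = parCutoff q * ((starRingEnd ℂ) (derivSymbol i a q) * ((symbolDenom i q)⁻¹ : ℝ)) := by
  have hc : ContDiff ℝ ∞ fun q : Rn1 n => (parCutoff q : ℂ) :=
    ofRealCLM.contDiff.comp (contDiff_parCutoff n)
  have hd : ContDiff ℝ ∞ fun q : Rn1 n => (((symbolDenom i q)⁻¹ : ℝ) : ℂ) :=
    ofRealCLM.contDiff.comp ((contDiff_symbolDenom n i).inv fun q => (symbolDenom_pos i q).ne')
  have hs : ContDiff ℝ ∞ fun q : Rn1 n => (starRingEnd ℂ) (derivSymbol i a q) :=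
    conjCLE.contDiff.comp (contDiff_derivSymbol i a)
  refine exists_FT1_eq (hc.mul (hs.mul hd)) ?_
  exact ((hasCompactSupport_parCutoff n).comp_left ofReal_zero).mul_right

theorem FT1_smul {n : ℕ} (c : ℂ) (f : 𝓢(Rn1 n, ℂ)) (q : Rn1 n) :
    FT1 (c • f : 𝓢(Rn1 n, ℂ)) q = c * FT1 f q := by
  simpa using FT1_sum_smul {()} (fun _ => c) (fun _ => f) q

theorem parDilation_parDilation_inv {n : ℕ} (r : ℝˣ) (q : Rn1 n) :
    parDilation n r (parDilation n r⁻¹ q) = q := by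
  have hr : (r : ℝ) ≠ 0 := r.ne_zero
  refine Prod.ext ?_ ?_
  · simp [parDilation_apply]
  · simp [parDilation_apply]

theorem ParabolicLP.FT1_φ_eq_zero_or {n : ℕ} (P : ParabolicLP n) (q : Rn1 n) :
    FT1 P.φ q = 0 ∨
      1 / 2 ≤ ‖q.1‖ + |q.2| ^ ((1 : ℝ) / 2) ∧ ‖q.1‖ + |q.2| ^ ((1 : ℝ) / 2) ≤ 2 := by
  by_cases h : 1 / 2 < ‖q.1‖ + |q.2| ^ ((1 : ℝ) / 2) ∧ ‖q.1‖ + |q.2| ^ ((1 : ℝ) / 2) < 2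
  · exact Or.inr ⟨h.1.le, h.2.le⟩
  · exact Or.inl (P.ft_supp q h)

theorem ParabolicLP.FT1_ψ_eq_zero_or {n : ℕ} (P : ParabolicLP n) (q : Rn1 n) :
    FT1 P.ψ q = 0 ∨ ‖q.1‖ + |q.2| ^ ((1 : ℝ) / 2) ≤ 2 := by
  by_cases h : ‖q.1‖ + |q.2| ^ ((1 : ℝ) / 2) ≤ 2
  · exact Or.inr h
  left
  have hq : q ≠ 0 := by
    rintro rfl
    exact h (by simp)
  have hinj : Function.Injective fun k : ℕ => (k : ℤ) + 1 := fun a b hab => by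
    simpa using hab
  have hsupp : (Function.support fun k : ℤ =>
      FT1 P.φ (((2 : ℝ) ^ (-k)) • q.1, ((2 : ℝ) ^ (-(2 * k))) * q.2))
      ⊆ Set.range fun k : ℕ => (k : ℤ) + 1 := by
    intro k hk
    by_contra hk'
    have hk0 : k ≤ 0 := by
      by_contra! hpos
      exact hk' ⟨(k - 1).toNat, by simp; omega⟩
    refine hk (P.ft_supp _ fun hlt => h (le_trans ?_ hlt.2.le))
    have hc : (1 : ℝ) ≤ 2 ^ (-k) := one_le_zpow₀ (by norm_num) (by omega)
    have hc2 : (1 : ℝ) ≤ 2 ^ (-(2 * k)) := one_le_zpow₀ (by norm_num) (by omega)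
    dsimp only
    refine add_le_add ?_ (Real.rpow_le_rpow (abs_nonneg _) ?_ (by norm_num))
    · rw [norm_smul, Real.norm_of_nonneg (by positivity)]
      exact le_mul_of_one_le_left (norm_nonneg _) hc
    · rw [abs_mul, abs_of_pos (by positivity : (0 : ℝ) < 2 ^ (-(2 * k)))]
      exact le_mul_of_one_le_left (abs_nonneg _) hc2
  have hsum := P.ft_sum q hq
  rw [← hinj.tsum_eq hsupp] at hsum
  rw [P.ft_psi, hsum, sub_self]

/-- If `𝓕Θ` lives in the unit-scale parabolic ball of radius `2`, a derivative of total parabolic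
order `2i` costs a factor `r^{2i}` on functions localized by the dilate of `Θ`. -/
theorem eLpNorm_conv1_derivOp_le {n i : ℕ} {p : ℝ} (hp : 1 ≤ p) {a : Option (Fin n → ℕ)}
    (ha : a ∈ (multiIdx n (2 * i)).insertNone) {K Θ : 𝓢(Rn1 n, ℂ)}
    (hK : ∀ q, FT1 K q = parCutoff q * derivSymbol i a q)
    (hΘ : ∀ q : Rn1 n, FT1 Θ q = 0 ∨ ‖q.1‖ + |q.2| ^ ((1 : ℝ) / 2) ≤ 2)
    (r : ℝˣ) (f : 𝓢(Rn1 n, ℂ)) :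
    eLpNorm (conv1 (schwartzDilate r Θ) (derivOp i a f)) (ENNReal.ofReal p) volume
      ≤ ENNReal.ofReal ((r : ℝ) ^ (2 * i)) * (eLpNorm K 1 volume *
        eLpNorm (conv1 (schwartzDilate r Θ) f) (ENNReal.ofReal p) volume) := by
  obtain ⟨g, hg, hF⟩ := exists_derivOp i a f
  have key : schwartzConv (schwartzDilate r Θ) g
      = ((r : ℂ) ^ (2 * i)) • schwartzConv (schwartzDilate r K)
        (schwartzConv (schwartzDilate r Θ) f) := by
    refine FT1_injective fun q => ?_
    simp only [FT1_smul, FT1_schwartzConv, FT1_schwartzDilate, hF, hK]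
    have hm := derivSymbol_parDilation ha r (parDilation n r⁻¹ q)
    rw [parDilation_parDilation_inv] at hm
    rcases hΘ (parDilation n r⁻¹ q) with h | h
    · simp [h]
    · rw [hm, parCutoff_eq_one h]
      push_cast
      ring
  rw [← hg, ← coe_schwartzConv, key, ← coe_schwartzConv]
  change eLpNorm (((r : ℂ) ^ (2 * i)) • ⇑(schwartzConv (schwartzDilate r K)
    (schwartzConv (schwartzDilate r Θ) f))) _ _ ≤ _
  rw [eLpNorm_const_smul, coe_schwartzConv]
  gcongr
  · rw [← ofReal_norm, norm_pow, Complex.norm_real, Real.norm_eq_abs, pow_mul, pow_mul, sq_abs]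
  · exact (eLpNorm_conv1_le hp _ _).trans_eq (by rw [eLpNorm_schwartzDilate])

/-- On functions localized at the frequency scale `r`, the derivatives of parabolic order `2i`
control the function with a gain of `r^{-2i}`. -/
theorem eLpNorm_conv1_le_sum_derivOp {n i : ℕ} {p : ℝ} (hp : 1 ≤ p)
    {L : Option (Fin n → ℕ) → 𝓢(Rn1 n, ℂ)} {Θ : 𝓢(Rn1 n, ℂ)}
    (hL : ∀ a q, FT1 (L a) q
      = parCutoff q * ((starRingEnd ℂ) (derivSymbol i a q) * ((symbolDenom i q)⁻¹ : ℝ)))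
    (hΘ : ∀ q : Rn1 n, FT1 Θ q = 0 ∨
      1 / 2 ≤ ‖q.1‖ + |q.2| ^ ((1 : ℝ) / 2) ∧ ‖q.1‖ + |q.2| ^ ((1 : ℝ) / 2) ≤ 2)
    (r : ℝˣ) (f : 𝓢(Rn1 n, ℂ)) :
    ENNReal.ofReal ((r : ℝ) ^ (2 * i)) *
        eLpNorm (conv1 (schwartzDilate r Θ) f) (ENNReal.ofReal p) volume
      ≤ ∑ a ∈ (multiIdx n (2 * i)).insertNone, eLpNorm (L a) 1 volume *
        eLpNorm (conv1 (schwartzDilate r Θ) (derivOp i a f)) (ENNReal.ofReal p) volume := by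
  choose g hg hF using fun a => exists_derivOp i a f
  have key : ((r : ℂ) ^ (2 * i)) • schwartzConv (schwartzDilate r Θ) f
      = ∑ a ∈ (multiIdx n (2 * i)).insertNone, (1 : ℂ) • schwartzConv (schwartzDilate r (L a))
        (schwartzConv (schwartzDilate r Θ) (g a)) := by
    refine FT1_injective fun q => ?_
    simp only [FT1_smul, FT1_sum_smul, FT1_schwartzConv, FT1_schwartzDilate, hF, hL, one_mul]
    rcases hΘ (parDilation n r⁻¹ q) with h | ⟨h1, h2⟩
    · simp [h]
    · set q' := parDilation n r⁻¹ q with hq'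
      have hS : (symbolDenom i q' : ℂ) = ∑ a ∈ (multiIdx n (2 * i)).insertNone,
          (starRingEnd ℂ) (derivSymbol i a q') * derivSymbol i a q' := by
        rw [symbolDenom_eq i h1]
        simp [Complex.conj_mul']
      have hne : (symbolDenom i q' : ℂ) ≠ 0 := by exact_mod_cast (symbolDenom_pos i q').ne'
      rw [parCutoff_eq_one h2]
      calc (r : ℂ) ^ (2 * i) * (FT1 Θ q' * FT1 f q)
          = (r : ℂ) ^ (2 * i) * FT1 Θ q' * FT1 f q * (symbolDenom i q' : ℂ)⁻¹
              * (symbolDenom i q' : ℂ) := by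
            field_simp
        _ = _ := by
            nth_rw 2 [hS]
            rw [Finset.mul_sum]
            refine Finset.sum_congr rfl fun a ha => ?_
            have hm := derivSymbol_parDilation ha r q'
            rw [hq', parDilation_parDilation_inv, ← hq'] at hm
            rw [hm]
            push_cast
            ring
  have hl : ENNReal.ofReal ((r : ℝ) ^ (2 * i)) *
      eLpNorm (conv1 (schwartzDilate r Θ) f) (ENNReal.ofReal p) volume
      = eLpNorm (((r : ℂ) ^ (2 * i)) • schwartzConv (schwartzDilate r Θ) f : 𝓢(Rn1 n, ℂ))
        (ENNReal.ofReal p) volume := by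
    change _ = eLpNorm (((r : ℂ) ^ (2 * i)) • ⇑(schwartzConv (schwartzDilate r Θ) f)) _ _
    rw [eLpNorm_const_smul, coe_schwartzConv]
    congr 1
    rw [← ofReal_norm, norm_pow, Complex.norm_real, Real.norm_eq_abs, pow_mul, pow_mul, sq_abs]
  have hcoe : ⇑(∑ a ∈ (multiIdx n (2 * i)).insertNone, (1 : ℂ) •
      schwartzConv (schwartzDilate r (L a)) (schwartzConv (schwartzDilate r Θ) (g a)))
      = ∑ a ∈ (multiIdx n (2 * i)).insertNone,
        conv1 (schwartzDilate r (L a)) (schwartzConv (schwartzDilate r Θ) (g a)) := by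
    ext x
    simp only [one_smul, _root_.sum_apply, Finset.sum_apply, coe_schwartzConv]
  rw [hl, key, hcoe]
  refine (eLpNorm_sum_le (fun a _ => ?_) (by simpa using hp)).trans
    (Finset.sum_le_sum fun a _ => ?_)
  · rw [← coe_schwartzConv]
    exact (SchwartzMap.continuous _).aestronglyMeasurable
  · refine (eLpNorm_conv1_le hp _ _).trans_eq ?_
    rw [eLpNorm_schwartzDilate, coe_schwartzConv, hg]

theorem tsum_rpow_sum_le {ι : Type*} {p : ℝ} (hp : 1 ≤ p) (s : Finset ι) (x : ι → ℕ → ℝ≥0∞) :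
    (∑' k, (∑ a ∈ s, x a k) ^ p) ^ (1 / p) ≤ ∑ a ∈ s, (∑' k, x a k ^ p) ^ (1 / p) := by
  have hp0 : 0 < p := by linarith
  classical
  induction s using Finset.induction_on with
  | empty => simp [hp0]
  | insert a s ha ih =>
    simp only [Finset.sum_insert ha]
    refine le_trans ?_ (add_le_add le_rfl ih)
    simpa [lintegral_count] using ENNReal.lintegral_Lp_add_le (μ := Measure.count)
      (f := x a) (g := fun k => ∑ b ∈ s, x b k) (by fun_prop) (by fun_prop) hp

theorem tsum_rpow_const_mul {p : ℝ} (hp : 1 ≤ p) (c : ℝ≥0∞) (x : ℕ → ℝ≥0∞) :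
    (∑' k, (c * x k) ^ p) ^ (1 / p) = c * (∑' k, x k ^ p) ^ (1 / p) := by
  have hp0 : 0 < p := by linarith
  simp_rw [ENNReal.mul_rpow_of_nonneg _ _ hp0.le]
  rw [ENNReal.tsum_mul_left, ENNReal.mul_rpow_of_nonneg _ _ (by positivity), ← ENNReal.rpow_mul,
    mul_one_div_cancel hp0.ne', ENNReal.rpow_one]

theorem tsum_rpow_mono {p : ℝ} (hp : 1 ≤ p) {x y : ℕ → ℝ≥0∞} (h : ∀ k, x k ≤ y k) :
    (∑' k, x k ^ p) ^ (1 / p) ≤ (∑' k, y k ^ p) ^ (1 / p) := by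
  have hp0 : 0 ≤ p := by linarith
  gcongr with k
  exact h k

theorem besov_weight_mul (α : ℝ) (i k : ℕ) :
    ENNReal.ofReal ((2 : ℝ) ^ ((α - 2 * i) * ((k : ℝ) + 1)))
      * ENNReal.ofReal (((twoPow (k + 1) : ℝˣ) : ℝ) ^ (2 * i))
      = ENNReal.ofReal ((2 : ℝ) ^ (α * ((k : ℝ) + 1))) := by
  rw [← ENNReal.ofReal_mul (by positivity)]
  congr 1
  have : ((twoPow (k + 1) : ℝˣ) : ℝ) ^ (2 * i) = (2 : ℝ) ^ ((2 * i) * ((k : ℝ) + 1)) := by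
    simp only [twoPow, Units.val_mk0]
    rw [← pow_mul, ← Real.rpow_natCast]
    push_cast
    ring_nf
  rw [this, ← Real.rpow_add two_pos]
  ring_nf

theorem pBesov_mono {n : ℕ} (P : ParabolicLP n) {s α p : ℝ} (hp : 1 ≤ p) (h : s ≤ α)
    (f : Rn1 n → ℂ) : pBesov P s p f ≤ pBesov P α p f := by
  refine add_le_add le_rfl (tsum_rpow_mono hp fun k => ?_)
  gcongr
  norm_num

theorem pBesov_derivOp_le {n i : ℕ} (P : ParabolicLP n) (α : ℝ) {p : ℝ} (hp : 1 ≤ p)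
    {a : Option (Fin n → ℕ)} (ha : a ∈ (multiIdx n (2 * i)).insertNone) {K : 𝓢(Rn1 n, ℂ)}
    (hK : ∀ q, FT1 K q = parCutoff q * derivSymbol i a q) (f : 𝓢(Rn1 n, ℂ)) :
    pBesov P (α - 2 * i) p (derivOp i a f) ≤ eLpNorm K 1 volume * pBesov P α p f := by
  rw [pBesov, pBesov, mul_add, ← tsum_rpow_const_mul hp]
  refine add_le_add ?_ (tsum_rpow_mono hp fun k => ?_)
  · have h1 : schwartzDilate 1 P.ψ = P.ψ := by
      ext x
      simp [schwartzDilate_apply, parDilation_apply]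
    simpa [h1] using eLpNorm_conv1_derivOp_le hp ha hK P.FT1_ψ_eq_zero_or 1 f
  · have := eLpNorm_conv1_derivOp_le hp ha hK (fun q => (P.FT1_φ_eq_zero_or q).imp_right And.right)
      (twoPow (k + 1)) f
    rw [← lpPhi_eq_schwartzDilate] at this
    refine (mul_le_mul_right this _).trans_eq ?_
    rw [← mul_assoc, besov_weight_mul]
    ring

theorem pBesov_le_sum_derivOp {n : ℕ} (i : ℕ) (P : ParabolicLP n) (α : ℝ) {p : ℝ} (hp : 1 ≤ p)
    {L : Option (Fin n → ℕ) → 𝓢(Rn1 n, ℂ)}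
    (hL : ∀ a q, FT1 (L a) q
      = parCutoff q * ((starRingEnd ℂ) (derivSymbol i a q) * ((symbolDenom i q)⁻¹ : ℝ)))
    (f : 𝓢(Rn1 n, ℂ)) :
    pBesov P α p f ≤ pBesov P (α - 2 * i) p f + ∑ a ∈ (multiIdx n (2 * i)).insertNone,
      eLpNorm (L a) 1 volume * pBesov P (α - 2 * i) p (derivOp i a f) := by
  rw [pBesov]
  refine add_le_add le_self_add ?_
  calc _ ≤ (∑' k : ℕ, (∑ a ∈ (multiIdx n (2 * i)).insertNone, eLpNorm (L a) 1 volume *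
          (ENNReal.ofReal ((2 : ℝ) ^ ((α - 2 * i) * ((k : ℝ) + 1))) * eLpNorm
            (conv1 (lpPhi P (k + 1)) (derivOp i a f)) (ENNReal.ofReal p) volume)) ^ p)
              ^ (1 / p) := by
        refine tsum_rpow_mono hp fun k => ?_
        have := eLpNorm_conv1_le_sum_derivOp hp hL P.FT1_φ_eq_zero_or (twoPow (k + 1)) f
        rw [← lpPhi_eq_schwartzDilate] at this
        rw [← besov_weight_mul α i, mul_assoc]
        refine (mul_le_mul_right this _).trans_eq ?_
        rw [Finset.mul_sum]
        exact Finset.sum_congr rfl fun a _ => by ring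
    _ ≤ _ := by
        refine (tsum_rpow_sum_le hp _ _).trans (Finset.sum_le_sum fun a _ => ?_)
        rw [tsum_rpow_const_mul hp]
        gcongr
        exact le_add_self

/-- For `2i < α < 2i+2`,
`N_{α,p}(f) ≈ N_{α−2i,p}(f) + Σ_{|β|=2i} N_{α−2i,p}(D_X^β f) + N_{α−2i,p}(D_t^i f)`. -/
theorem stmt10 (n : ℕ) (hn : 1 ≤ n) (p : ℝ) (hp : 1 ≤ p) (i : ℕ) (hi : 1 ≤ i) (α : ℝ)
    (hα1 : 2 * (i : ℝ) < α) (hα2 : α < 2 * (i : ℝ) + 2) (P : ParabolicLP n) :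
    ∃ c C : ℝ, 0 < c ∧ 0 < C ∧
      ∀ f : SchwartzMap (Rn1 n) ℂ,
        ENNReal.ofReal c * pBesov P α p ⇑f ≤
            pBesov P (α - 2 * i) p ⇑f
            + ∑ β ∈ multiIdx n (2 * i), pBesov P (α - 2 * i) p (dXmulti β ⇑f)
            + pBesov P (α - 2 * i) p (dT^[i] ⇑f)
          ∧
          pBesov P (α - 2 * i) p ⇑f
            + ∑ β ∈ multiIdx n (2 * i), pBesov P (α - 2 * i) p (dXmulti β ⇑f)
            + pBesov P (α - 2 * i) p (dT^[i] ⇑f)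
            ≤ ENNReal.ofReal C * pBesov P α p ⇑f := by
  choose K hK using exists_derivative_kernel n i
  choose L hL using exists_inverse_kernel n i
  set S := (multiIdx n (2 * i)).insertNone with hS
  have hconst (G : Option (Fin n → ℕ) → SchwartzMap (Rn1 n) ℂ) :
      ∃ C : ℝ, 0 < C ∧ ENNReal.ofReal C = 1 + ∑ a ∈ S, eLpNorm (G a) 1 volume := by
    have hfin : 1 + ∑ a ∈ S, eLpNorm (G a) 1 volume ≠ ⊤ :=
      ENNReal.add_ne_top.2 ⟨ENNReal.one_ne_top,
        ENNReal.sum_ne_top.2 fun a _ => ((G a).memLp 1 volume).2.ne⟩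
    exact ⟨_, ENNReal.toReal_pos (by simp) hfin, ENNReal.ofReal_toReal hfin⟩
  obtain ⟨C, hC, hCK⟩ := hconst K
  obtain ⟨D, hD, hDL⟩ := hconst L
  refine ⟨D⁻¹, C, inv_pos.2 hD, hC, fun f => ?_⟩
  have hsum : pBesov P (α - 2 * i) p f
      + ∑ β ∈ multiIdx n (2 * i), pBesov P (α - 2 * i) p (dXmulti β f)
      + pBesov P (α - 2 * i) p (dT^[i] f)
      = pBesov P (α - 2 * i) p f + ∑ a ∈ S, pBesov P (α - 2 * i) p (derivOp i a f) := by
    rw [hS, Finset.sum_insertNone, add_assoc]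
    congr 1
    exact add_comm _ _
  rw [hsum]
  constructor
  · rw [ENNReal.ofReal_inv_of_pos hD, ENNReal.inv_mul_le_iff (by simpa using hD)
      ENNReal.ofReal_ne_top, hDL]
    refine (pBesov_le_sum_derivOp i P α hp hL f).trans ?_
    rw [add_mul, one_mul, Finset.sum_mul]
    gcongr with a ha
    · exact le_self_add
    · exact (Finset.single_le_sum (f := fun a => pBesov P (α - 2 * i) p (derivOp i a f))
        (fun _ _ => zero_le) ha).trans le_add_self
  · rw [hCK, add_mul, one_mul, Finset.sum_mul]
    exact add_le_add (pBesov_mono P hp (by linarith [(Nat.cast_nonneg i : (0 : ℝ) ≤ i)]) f)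
      (Finset.sum_le_sum fun a ha => pBesov_derivOp_le P α hp ha (hK a) f)
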